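/- Let K be an imaginary quadratic field and let M ⊆ K² be a full ℤ-lattice (a finitely generated ℤ-submodule spanning K² over ℚ, equivalently free of rank 4 over ℤ). Then there exist a positive integer f and a rank-1 K-lattice 𝔞 ⊆ K of conductor f′ dividing f such that γ·M = O_f ⊕ 𝔞 for some γ ∈ GL₂(K). Moreover, the integers f and f′ are uniquely determined by M, and 𝔞 is uniquely determined up to homothety (i.e., if also γ′·M = O_f ⊕ 𝔟 with 𝔟 of conductor f′, then 𝔟 = λ·𝔞 for some λ ∈ K^×). -/

import Mathlib

open scoped Pointwise

noncomputable section

variable (K : Type) [Field K] [NumberField K]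

/-- The underlying set of the order `ℤ + m·O_K` of conductor `m` in `K`. -/
def orderSet (m : ℕ) : Set K :=
  {x : K | ∃ (a : ℤ) (y : NumberField.RingOfIntegers K),
    x = (a : K) + (m : K) * algebraMap (NumberField.RingOfIntegers K) K y}

/-- The order `ℤ + m·O_K` of conductor `m`, as a `ℤ`-submodule of `K`. -/
def orderLat (m : ℕ) : Submodule ℤ K where
  carrier := orderSet K m
  add_mem' := by
    rintro x y ⟨a, u, rfl⟩ ⟨b, v, rfl⟩
    exact ⟨a + b, u + v, by rw [map_add]; push_cast; ring⟩
  zero_mem' := ⟨0, 0, by simp⟩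
  smul_mem' := by
    rintro n x ⟨a, u, rfl⟩
    refine ⟨n * a, n • u, ?_⟩
    rw [map_zsmul, zsmul_eq_mul, zsmul_eq_mul]
    push_cast
    ring

/-- `L` is a rank-1 `K`-lattice: a finitely generated `ℤ`-submodule of `K`
spanning `K` over `ℚ`. -/
def IsLat (L : Submodule ℤ K) : Prop :=
  L.FG ∧ Submodule.span ℚ (L : Set K) = ⊤

/-- The multiplier ring `R(L) = {α ∈ K : α·L ⊆ L}` of a lattice, as a `ℤ`-submodule. -/
def multLat (L : Submodule ℤ K) : Submodule ℤ K where
  carrier := {α : K | ∀ x ∈ L, α * x ∈ L}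
  add_mem' := by
    intro a b ha hb x hx
    rw [add_mul]; exact L.add_mem (ha x hx) (hb x hx)
  zero_mem' := by intro x hx; rw [zero_mul]; exact L.zero_mem
  smul_mem' := by
    intro n a ha x hx
    rw [smul_mul_assoc]; exact L.smul_mem n (ha x hx)

/-- `L` has conductor `c`, i.e. the multiplier ring of `L` is the order `ℤ + c·O_K`. -/
def HasCond (L : Submodule ℤ K) (c : ℕ) : Prop :=
  0 < c ∧ (multLat K L : Set K) = orderSet K c

/-- The lattice `A ⊕ B = {(x,y) ∈ K² : x ∈ A, y ∈ B}` in `K²`. -/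
def latPair (A B : Submodule ℤ K) : Submodule ℤ (Fin 2 → K) :=
  A.comap (LinearMap.proj (R := ℤ) (φ := fun _ : Fin 2 => K) 0) ⊓
    B.comap (LinearMap.proj (R := ℤ) (φ := fun _ : Fin 2 => K) 1)


theorem exists_bezout_of_not_dvd {p : ℕ} (hp : p.Prime) {k : ℤ} (h : ¬ (p : ℤ) ∣ k) :
    ∃ r s : ℤ, r * k + s * p = 1 := by
  have := ((Nat.prime_iff_prime_int.mp hp).irreducible.coprime_iff_not_dvd).mpr h
  obtain ⟨s, r, e⟩ := this
  exact ⟨r, s, by linarith⟩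

section Module

variable {F V : Type*} [Field F] [AddCommGroup V] [Module F V]

/-- `x` is an eigenvector (or zero) of multiplication by `τ` modulo `p • L`. -/
def IsEigenMod (L : Submodule ℤ V) (τ : F) (p : ℕ) (x : V) : Prop :=
  ∃ a : ℤ, ∃ m ∈ L, τ • x - a • x = (p : ℤ) • m

variable (F) in
theorem zsmul_cancel_of_charZero [CharZero F] {d : ℤ} (hd : d ≠ 0) {x y : V} (h : d • x = d • y) : x = y := by
  rw [← Int.cast_smul_eq_zsmul F d x, ← Int.cast_smul_eq_zsmul F d y] at h
  exact smul_right_injective V (Int.cast_ne_zero.mpr hd : (d : F) ≠ 0) h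

theorem IsEigenMod.of_sub_eq {L : Submodule ℤ V} {τ : F} {p : ℕ}
    (hτ : ∀ x ∈ L, τ • x ∈ L) {x y m : V} (hm : m ∈ L) (hxy : x - y = (p : ℤ) • m)
    (hx : IsEigenMod L τ p x) : IsEigenMod L τ p y := by
  obtain ⟨a, k, hk, e⟩ := hx
  refine ⟨a, k - (τ • m - a • m), L.sub_mem hk (L.sub_mem (hτ m hm) (L.smul_mem a hm)), ?_⟩
  obtain rfl : x = y + (p : ℤ) • m := by rw [← hxy]; abel
  rw [smul_sub, ← e]
  module

theorem exists_mem_congr {L : Submodule ℤ V} (s : Finset ℕ) (hs : ∀ p ∈ s, p.Prime)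
    (X : ℕ → V) (hX : ∀ p ∈ s, X p ∈ L) :
    ∃ x ∈ L, ∀ p ∈ s, ∃ m ∈ L, X p - x = (p : ℤ) • m := by
  induction s using Finset.induction_on with
  | empty => exact ⟨0, L.zero_mem, by simp⟩
  | insert q s hq ih =>
    obtain ⟨x, hx, hxs⟩ := ih (fun p hp => hs p (Finset.mem_insert_of_mem hp))
      (fun p hp => hX p (Finset.mem_insert_of_mem hp))
    have hqp := hs q (Finset.mem_insert_self q s)
    have hXq := hX q (Finset.mem_insert_self q s)
    have hnd : ¬ (q : ℤ) ∣ ∏ p ∈ s, (p : ℤ) := by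
      rw [(Nat.prime_iff_prime_int.mp hqp).dvd_finsetProd_iff]
      rintro ⟨p, hp, hd⟩
      have hd' := (Nat.prime_dvd_prime_iff_eq hqp
        (hs p (Finset.mem_insert_of_mem hp))).mp (Int.natCast_dvd_natCast.mp hd)
      exact hq (hd' ▸ hp)
    obtain ⟨r, t, e⟩ := exists_bezout_of_not_dvd hqp hnd
    set c := ∏ p ∈ s, (p : ℤ) with hc
    have hd : X q - x ∈ L := L.sub_mem hXq hx
    refine ⟨x + (r * c) • (X q - x), L.add_mem hx (L.smul_mem _ hd), fun p hp => ?_⟩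
    rcases Finset.mem_insert.mp hp with rfl | hp
    · refine ⟨t • (X p - x), L.smul_mem _ hd, ?_⟩
      have : r * c = 1 - t * p := by linarith
      rw [this]
      module
    · obtain ⟨m, hm, em⟩ := hxs p hp
      obtain ⟨c', hc'⟩ : (p : ℤ) ∣ c := Finset.dvd_prod_of_mem _ hp
      refine ⟨m - (r * c') • (X q - x), L.sub_mem hm (L.smul_mem _ hd), ?_⟩
      rw [smul_sub (p : ℤ) m, ← em, hc']
      module

theorem IsEigenMod.uniform {L : Submodule ℤ V} {τ : F} {p : ℕ} (hp : p.Prime)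
    (hτ : ∀ x ∈ L, τ • x ∈ L) (h : ∀ x ∈ L, IsEigenMod L τ p x) :
    ∃ a : ℤ, ∀ x ∈ L, ∃ m ∈ L, τ • x - a • x = (p : ℤ) • m := by
  by_cases hL : ∀ x ∈ L, ∃ m ∈ L, x = (p : ℤ) • m
  · exact ⟨0, fun x hx => by simpa using hL _ (hτ x hx)⟩
  push Not at hL
  obtain ⟨x, hx, hxp⟩ := hL
  obtain ⟨a, m, hm, ea⟩ := h x hx
  refine ⟨a, fun y hy => ?_⟩
  obtain ⟨b, k, hk, eb⟩ := h y hy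
  obtain ⟨c, l, hl, ec⟩ := h (x + y) (L.add_mem hx hy)
  have key : (a - c) • x + (b - c) • y = (p : ℤ) • (l - m - k) := by
    rw [smul_sub, smul_sub, ← ea, ← eb, ← ec]
    module
  have hlmk : l - m - k ∈ L := L.sub_mem (L.sub_mem hl hm) hk
  by_cases hbc : (p : ℤ) ∣ b - c
  · obtain ⟨w, hw⟩ := hbc
    have hac : (p : ℤ) ∣ a - c := by
      by_contra hac
      obtain ⟨r, s, e⟩ := exists_bezout_of_not_dvd hp hac
      apply hxp (r • (l - m - k - w • y) + s • x)
        (L.add_mem (L.smul_mem _ (L.sub_mem hlmk (L.smul_mem _ hy))) (L.smul_mem _ hx))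
      have : (a - c) • x = (p : ℤ) • (l - m - k - w • y) := by
        rw [smul_sub, ← key, hw]; module
      calc x = (r * (a - c) + s * p) • x := by rw [e, one_smul]
        _ = r • ((a - c) • x) + (s * p) • x := by module
        _ = _ := by rw [this]; module
    obtain ⟨z, hz⟩ := hac
    refine ⟨k + (w - z) • y, L.add_mem hk (L.smul_mem _ hy), ?_⟩
    rw [smul_add, ← eb]
    have : b = a + p * (w - z) := by linarith
    rw [this]; module
  · obtain ⟨r, s, e⟩ := exists_bezout_of_not_dvd hp hbc
    have hy' : y = (r * (c - a)) • x + (p : ℤ) • (r • (l - m - k) + s • y) := by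
      calc y = (r * (b - c) + s * p) • y := by rw [e, one_smul]
        _ = r • (((a - c) • x + (b - c) • y)) + (r * (c - a)) • x + (s * p) • y := by module
        _ = _ := by rw [key]; module
    set q := r • (l - m - k) + s • y with hq
    have hqL : q ∈ L := L.add_mem (L.smul_mem _ hlmk) (L.smul_mem _ hy)
    refine ⟨(r * (c - a)) • m + (τ • q - a • q), L.add_mem (L.smul_mem _ hm)
      (L.sub_mem (hτ q hqL) (L.smul_mem _ hqL)), ?_⟩
    calc τ • y - a • y
        = (r * (c - a)) • (τ • x - a • x) + (p : ℤ) • (τ • q - a • q) := by rw [hy']; module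
      _ = _ := by rw [ea]; module

theorem exists_add_not_isEigenMod {L P : Submodule ℤ V} {τ : F} {p : ℕ}
    (hp : p.Prime) (hτ : ∀ x ∈ L, τ • x ∈ L) (hτP : ∀ x ∈ P, τ • x ∈ P) {v w : V} (hw : w ∈ P)
    (hwp : ¬ IsEigenMod L τ p w) (hv : v ∈ L) : ∃ k ∈ P, ¬ IsEigenMod L τ p (v + k) := by
  by_contra! H
  by_cases hvP : ∃ c ∈ P, ∃ m ∈ L, v = c + (p : ℤ) • m
  · obtain ⟨c, hc, m, hm, rfl⟩ := hvP
    exact hwp ((H (w - c) (P.sub_mem hw hc)).of_sub_eq hτ hm (by abel))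
  obtain ⟨a, m, hm, ea⟩ := H 0 P.zero_mem
  obtain ⟨b, k, hk, eb⟩ := H w hw
  rw [add_zero] at ea
  have key : (b - a) • v = τ • w - b • w + (p : ℤ) • (m - k) := by
    rw [smul_sub, ← ea, ← eb]; module
  by_cases hba : (p : ℤ) ∣ b - a
  · obtain ⟨c, hc⟩ := hba
    refine hwp ⟨b, k - m + c • v, L.add_mem (L.sub_mem hk hm) (L.smul_mem _ hv), ?_⟩
    rw [hc] at key
    have : τ • w - b • w = ((p : ℤ) * c) • v - (p : ℤ) • (m - k) := by rw [key]; abel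
    rw [this]; module
  · obtain ⟨r, s, e⟩ := exists_bezout_of_not_dvd hp hba
    refine hvP ⟨r • (τ • w - b • w), P.smul_mem _ (P.sub_mem (hτP w hw) (P.smul_mem _ hw)),
      r • (m - k) + s • v, L.add_mem (L.smul_mem _ (L.sub_mem hm hk)) (L.smul_mem _ hv), ?_⟩
    calc v = (r * (b - a) + s * p) • v := by rw [e, one_smul]
      _ = r • ((b - a) • v) + (s * p) • v := by module
      _ = _ := by rw [key]; module

end Module

theorem Submodule.FG.exists_common_denom {W U : Type*} [AddCommGroup W] [AddCommGroup U]
    {N : Submodule ℤ W} (hN : N.FG) (Q : Submodule ℤ U) (g : W →ₗ[ℤ] U)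
    (h : ∀ y, ∃ d : ℤ, d ≠ 0 ∧ d • g y ∈ Q) : ∃ d : ℤ, d ≠ 0 ∧ ∀ y ∈ N, d • g y ∈ Q := by
  obtain ⟨S, rfl⟩ := hN
  choose d hd0 hd using h
  refine ⟨∏ s ∈ S, d s, Finset.prod_ne_zero_iff.mpr fun s _ => hd0 s, fun y hy => ?_⟩
  suffices H : Submodule.span ℤ (S : Set W) ≤ Q.comap ((∏ s ∈ S, d s) • g) from H hy
  rw [Submodule.span_le]
  intro s hs
  obtain ⟨c, hc⟩ : d s ∣ ∏ s ∈ S, d s := Finset.dvd_prod_of_mem _ hs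
  change (∏ s ∈ S, d s) • g s ∈ Q
  rw [hc, mul_comm, mul_smul]
  exact Q.smul_mem _ (hd s)

/-- `τ` is a quadratic irrationality with `τ² = tτ - n` generating the field `F` over `ℚ`. -/
structure IsQuadGen {F : Type*} [Field F] (τ : F) (t n : ℤ) : Prop where
  sq : τ * τ = t * τ - n
  indep : ∀ a b : ℤ, (a : F) + b * τ = 0 → a = 0 ∧ b = 0
  denom : ∀ x : F, ∃ d : ℤ, d ≠ 0 ∧ ∃ a b : ℤ, (d : F) * x = a + b * τ

namespace IsQuadGen

variable {F : Type*} [Field F] {τ : F} {t n : ℤ}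

theorem ext_iff (h : IsQuadGen τ t n) {a b c d : ℤ} (e : (a : F) + b * τ = c + d * τ) :
    a = c ∧ b = d := by
  have := h.indep (a - c) (b - d) (by push_cast; linear_combination e)
  omega

theorem nat_mul (h : IsQuadGen τ t n) {f : ℕ} (hf : 0 < f) :
    IsQuadGen ((f : F) * τ) (f * t) (f ^ 2 * n) where
  sq := by push_cast; linear_combination (f : F) ^ 2 * h.sq
  indep a b e := by
    have := h.indep a (b * f) (by push_cast; linear_combination e)
    refine ⟨this.1, ?_⟩
    rcases mul_eq_zero.mp this.2 with h | h <;> omega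
  denom x := by
    obtain ⟨d, hd, a, b, e⟩ := h.denom x
    refine ⟨f * d, by positivity, f * a, b, ?_⟩
    push_cast
    linear_combination (f : F) * e

end IsQuadGen

section Lattice

variable {F V : Type*} [Field F] [CharZero F] [AddCommGroup V] [Module F V]
  {τ ω : F} {t n : ℤ}

theorem exists_coeff_of_smul_mem (hτ : IsQuadGen τ t n) {L : Submodule ℤ V}
    (hL : ∀ x ∈ L, τ • x ∈ L) {x : V} (hx : x ∈ L)
    (hgood : ∀ p : ℕ, p.Prime → ¬ IsEigenMod L τ p x) {α : F} (hα : α • x ∈ L) :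
    ∃ a b : ℤ, α = a + b * τ := by
  have main : ∀ d : ℕ, d ≠ 0 → ∀ a b : ℤ, ∀ y ∈ L, a • x + b • (τ • x) = (d : ℤ) • y →
      (d : ℤ) ∣ a ∧ (d : ℤ) ∣ b := by
    intro d
    induction d using induction_on_primes with
    | zero => simp
    | one => simp
    | prime_mul p d hp ih =>
      intro hd a b y hy e
      push_cast at e
      have hb : (p : ℤ) ∣ b := by
        by_contra hb
        obtain ⟨r, s, h1⟩ := exists_bezout_of_not_dvd hp hb
        refine hgood p hp ⟨-(r * a), (r * d) • y + s • (τ • x),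
          L.add_mem (L.smul_mem _ hy) (L.smul_mem _ (hL x hx)), ?_⟩
        calc τ • x - (-(r * a)) • x
            = (r * b + s * p) • (τ • x) + (r * a) • x := by rw [h1]; module
          _ = r • (a • x + b • (τ • x)) + (s * p) • (τ • x) := by module
          _ = _ := by rw [e]; module
      obtain ⟨b, rfl⟩ := hb
      have ha : (p : ℤ) ∣ a := by
        by_contra ha
        obtain ⟨r, s, h1⟩ := exists_bezout_of_not_dvd hp ha
        set z := (r * d) • y - (r * b) • (τ • x) + s • x with hz
        have hzL : z ∈ L := L.add_mem (L.sub_mem (L.smul_mem _ hy) (L.smul_mem _ (hL x hx)))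
          (L.smul_mem _ hx)
        refine hgood p hp ⟨0, τ • z, hL z hzL, ?_⟩
        have : x = (p : ℤ) • z := calc
          x = (r * a + s * p) • x := by rw [h1, one_smul]
          _ = r • (a • x + ((p : ℤ) * b) • (τ • x)) - (r * p * b) • (τ • x) + (s * p) • x := by
            module
          _ = _ := by rw [e, hz]; module
        calc τ • x - (0 : ℤ) • x = τ • ((p : ℤ) • z) := by rw [← this]; module
          _ = _ := by module
      obtain ⟨a, rfl⟩ := ha
      obtain ⟨h1, h2⟩ := ih (by rintro rfl; simp at hd) a b y hy
        (zsmul_cancel_of_charZero F (Int.natCast_ne_zero.mpr hp.ne_zero) (by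
          rw [← mul_smul, ← e]; module))
      push_cast
      exact ⟨mul_dvd_mul_left _ h1, mul_dvd_mul_left _ h2⟩
  obtain ⟨d, hd, a, b, e⟩ := hτ.denom α
  have h := main d.natAbs (by simpa using hd) a b (d.sign • α • x) (L.smul_mem _ hα) (by
    rw [← mul_smul, mul_comm, Int.sign_mul_natAbs]
    calc a • x + b • (τ • x) = ((a : F) + b * τ) • x := by module
      _ = _ := by rw [← e]; module)
  rw [Int.natAbs_dvd, Int.natAbs_dvd] at h
  obtain ⟨⟨a, rfl⟩, ⟨b, rfl⟩⟩ := h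
  refine ⟨a, b, mul_left_cancel₀ (Int.cast_ne_zero.mpr hd : (d : F) ≠ 0) ?_⟩
  rw [e]; push_cast; ring

/-- A generator `ω` of the ring of integers together with `1`. -/
structure IsIntegralGen (ω : F) (t n : ℤ) : Prop extends IsQuadGen ω t n where
  isIntegral_iff : ∀ x : F, IsIntegral ℤ x ↔ ∃ a b : ℤ, x = a + b * ω

omit [CharZero F] in
theorem exists_conductor (hω : IsIntegralGen ω t n) {L : Submodule ℤ V} (hfg : L.FG)
    (hne : L ≠ ⊥) (hfull : ∀ x : V, ∃ d : ℤ, d ≠ 0 ∧ d • x ∈ L) :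
    ∃ f : ℕ, 0 < f ∧ ∀ α : F, (∀ x ∈ L, α • x ∈ L) ↔ ∃ a b : ℤ, α = a + b * (f * ω) := by
  let J : Ideal ℤ :=
    { carrier := {b | ∀ x ∈ L, b • (ω • x) ∈ L}
      zero_mem' := fun x _ => by simp
      add_mem' := fun ha hb x hx => by rw [add_smul]; exact L.add_mem (ha x hx) (hb x hx)
      smul_mem' := fun c b hb x hx => by
        rw [smul_eq_mul, mul_smul]; exact L.smul_mem c (hb x hx) }
  have hJ : ∀ b, b ∈ J ↔ ∀ x ∈ L, b • (ω • x) ∈ L := fun b => Iff.rfl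
  obtain ⟨g, hg⟩ := (IsPrincipalIdealRing.principal J).principal
  obtain ⟨f, hfJ⟩ : ∃ f : ℕ, ∀ b, b ∈ J ↔ (f : ℤ) ∣ b := ⟨g.natAbs, fun b => by
    rw [hg, Ideal.submodule_span_eq, Ideal.mem_span_singleton, Int.natAbs_dvd]⟩
  refine ⟨f, ?_, fun α => ⟨fun h => ?_, ?_⟩⟩
  · obtain ⟨d, hd, H⟩ := hfg.exists_common_denom L
      ((LinearMap.lsmul F V ω).restrictScalars ℤ) (fun y => hfull _)
    have : d ∈ J := fun x hx => H x hx
    rw [hfJ] at this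
    rw [Nat.pos_iff_ne_zero]
    rintro h0
    rw [h0] at this
    simp at this
    exact hd this
  · obtain ⟨a, b, rfl⟩ := (hω.isIntegral_iff α).mp (isIntegral_of_smul_mem_submodule L hne hfg α h)
    have hb : b ∈ J := fun x hx => by
      have := L.sub_mem (h x hx) (L.smul_mem a hx)
      convert this using 1
      module
    obtain ⟨c, rfl⟩ := (hfJ b).mp hb
    exact ⟨a, c, by push_cast; ring⟩
  · rintro ⟨a, b, rfl⟩ x hx
    have := (hJ _).mp ((hfJ _).mpr (dvd_mul_right (f : ℤ) b)) x hx
    have := L.add_mem (L.smul_mem a hx) this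
    convert this using 1
    module

theorem exists_primitive_vector (hω : IsIntegralGen ω t n) {f : ℕ} (hf : 0 < f)
    {L : Submodule ℤ V} (hfg : L.FG)
    (hL : ∀ α : F, (∀ x ∈ L, α • x ∈ L) ↔ ∃ a b : ℤ, α = a + b * (f * ω))
    (hrank : ∀ u : V, ∃ v ∈ L, v ∉ Submodule.span F {u}) :
    ∃ x ∈ L, ∀ α : F, α • x ∈ L → ∃ a b : ℤ, α = a + b * (f * ω) := by
  have hτ := hω.toIsQuadGen.nat_mul hf
  set τ := (f : F) * ω with hτdef
  have hτL : ∀ x ∈ L, τ • x ∈ L := (hL τ).mpr ⟨0, 1, by simp⟩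
  have hnonscalar : ∀ p : ℕ, p.Prime → ∃ x ∈ L, ¬ IsEigenMod L τ p x := by
    intro p hp
    by_contra! H
    obtain ⟨a, ha⟩ := IsEigenMod.uniform hp hτL H
    have hp0 : (p : F) ≠ 0 := Nat.cast_ne_zero.mpr hp.ne_zero
    obtain ⟨c, d, e⟩ := (hL ((τ - a) / p)).mp fun x hx => by
      obtain ⟨m, hm, e⟩ := ha x hx
      have : ((τ - a) / p) • x = m := calc
        _ = (p : F)⁻¹ • (τ • x - a • x) := by module
        _ = ((p : F)⁻¹ * p) • m := by rw [e]; module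
        _ = m := by rw [inv_mul_cancel₀ hp0, one_smul]
      rwa [this]
    rw [div_eq_iff hp0] at e
    have := (hτ.ext_iff (a := -a) (b := 1) (c := c * p) (d := d * p)
      (by push_cast; linear_combination e)).2
    have h1 : (p : ℤ) ∣ 1 := ⟨d, by rw [this]; ring⟩
    exact hp.one_lt.ne' (by exact_mod_cast Int.eq_one_of_dvd_one (by positivity) h1)
  choose! X hXL hX using hnonscalar
  have hs : ∀ p ∈ insert 2 f.primeFactors, p.Prime := by
    intro p hp
    rcases Finset.mem_insert.mp hp with rfl | hp
    · exact Nat.prime_two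
    · exact Nat.prime_of_mem_primeFactors hp
  obtain ⟨u, huL, hu⟩ := exists_mem_congr _ hs X (fun p hp => hXL p (hs p hp))
  have hu' : ∀ p ∈ insert 2 f.primeFactors, ¬ IsEigenMod L τ p u := by
    intro p hp h
    obtain ⟨m, hm, e⟩ := hu p hp
    exact hX p (hs p hp) (h.of_sub_eq hτL (L.neg_mem hm) (by rw [smul_neg, ← e]; abel))
  have hu0 : u ≠ 0 := by
    rintro rfl
    exact hu' 2 (Finset.mem_insert_self _ _) ⟨0, 0, L.zero_mem, by simp⟩
  let P : Submodule ℤ V := L ⊓ (Submodule.span F {u}).restrictScalars ℤ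
  have hPL : P ≤ L := inf_le_left
  have huP : u ∈ P := ⟨huL, Submodule.mem_span_singleton_self u⟩
  have hτP : ∀ x ∈ P, τ • x ∈ P := fun x hx =>
    ⟨hτL x hx.1, (Submodule.span F {u}).smul_mem τ hx.2⟩
  have hPfg : P.FG := by
    have : IsNoetherian ℤ L := isNoetherian_of_fg_of_noetherian L hfg
    exact Submodule.FG.of_le hfg hPL
  have hPgood : ∀ p : ℕ, p.Prime → ∃ w ∈ P, ¬ IsEigenMod L τ p w := by
    intro p hp
    by_contra! H
    have hp0 : (p : F) ≠ 0 := Nat.cast_ne_zero.mpr hp.ne_zero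
    have key : ∀ (a : ℤ) (x m : V), τ • x - a • x = (p : ℤ) • m → m = ((τ - a) / p) • x := by
      intro a x m e
      calc m = ((p : F)⁻¹ * p) • m := by rw [inv_mul_cancel₀ hp0, one_smul]
        _ = (p : F)⁻¹ • ((p : ℤ) • m) := by module
        _ = _ := by rw [← e]; module
    have HP : ∀ x ∈ P, IsEigenMod P τ p x := by
      intro x hx
      obtain ⟨a, m, hm, e⟩ := H x hx
      refine ⟨a, m, ⟨hm, ?_⟩, e⟩
      rw [key a x m e]
      exact (Submodule.span F {u}).smul_mem _ hx.2
    obtain ⟨a, ha⟩ := IsEigenMod.uniform hp hτP HP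
    have hint : IsIntegral ℤ ((τ - a) / p) :=
      isIntegral_of_smul_mem_submodule P (fun h => hu0 (by rwa [h, Submodule.mem_bot] at huP))
        hPfg _ fun x hx => by
          obtain ⟨m, hm, e⟩ := ha x hx
          rwa [← key a x m e]
    obtain ⟨c, d, e⟩ := (hω.isIntegral_iff _).mp hint
    rw [div_eq_iff hp0] at e
    have := (hω.toIsQuadGen.ext_iff (a := -a) (b := f) (c := c * p) (d := d * p)
      (by push_cast; linear_combination e)).2
    have hpf : p ∣ f := Int.natCast_dvd_natCast.mp ⟨d, by rw [this]; ring⟩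
    exact hu' p (Finset.mem_insert_of_mem (Nat.mem_primeFactors.mpr ⟨hp, hpf, hf.ne'⟩))
      (H u huP)
  obtain ⟨v, hvL, hvu⟩ := hrank u
  obtain ⟨c₀, hc₀v, hc₀u⟩ := Submodule.exists_le_ker_of_notMem hvu
  let c : V →ₗ[F] F := (c₀ v)⁻¹ • c₀
  have hcv : c v = 1 := inv_mul_cancel₀ hc₀v
  have hcP : ∀ x ∈ P, c x = 0 := fun x hx => by
    have : c₀ x = 0 := hc₀u hx.2
    simp [c, this]
  obtain ⟨N, hN0, hN⟩ := hfg.exists_common_denom (Submodule.span ℤ {1, τ})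
    (c.restrictScalars ℤ) (fun y => by
      obtain ⟨d, hd, a, b, e⟩ := hτ.denom (c y)
      refine ⟨d, hd, Submodule.mem_span_pair.mpr ⟨a, b, ?_⟩⟩
      simp [e])
  have hlarge : ∀ p : ℕ, ¬ (p : ℤ) ∣ N → ∀ k ∈ P, ¬ IsEigenMod L τ p (v + k) := by
    rintro p hpN k hk ⟨a, m, hm, e⟩
    obtain ⟨A, B, e'⟩ := Submodule.mem_span_pair.mp (hN m hm)
    have h1 := congrArg c e
    simp only [map_sub, map_smul, map_zsmul, map_add, hcP k hk, hcv] at h1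
    simp only [zsmul_eq_mul, smul_eq_mul, LinearMap.coe_restrictScalars] at h1 e'
    push_cast at h1
    have := (hτ.ext_iff (a := -(N * a)) (b := N) (c := p * A) (d := p * B)
      (by push_cast; linear_combination (N : F) * h1 - (p : F) * e')).2
    exact hpN ⟨B, this⟩
  choose! w hwP hw using hPgood
  have hk : ∀ p : ℕ, p.Prime → ∃ k ∈ P, ¬ IsEigenMod L τ p (v + k) := fun p hp =>
    exists_add_not_isEigenMod hp hτL hτP (hwP p hp) (hw p hp) hvL
  choose! k hkP hk using hk
  have hsN : ∀ p ∈ N.natAbs.primeFactors, p.Prime := fun p => Nat.prime_of_mem_primeFactors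
  obtain ⟨κ, hκP, hκ⟩ := exists_mem_congr _ hsN k (fun p hp => hkP p (hsN p hp))
  have hx : v + κ ∈ L := L.add_mem hvL hκP.1
  refine ⟨v + κ, hx, fun α hα => exists_coeff_of_smul_mem hτ hτL hx (fun p hp h => ?_) hα⟩
  by_cases hpN : (p : ℤ) ∣ N
  · obtain ⟨m, hm, e⟩ := hκ p (Nat.mem_primeFactors.mpr
      ⟨hp, Int.natCast_dvd.mp hpN, by simpa using hN0⟩)
    exact hk p hp (h.of_sub_eq hτL (L.neg_mem hm.1) (by rw [smul_neg, ← e]; abel))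
  · exact hlarge p hpN κ hκP h

end Lattice

section Splitting

variable {F V : Type*} [Field F] [CharZero F] [AddCommGroup V] [Module F V] {τ : F} {t n : ℤ}

theorem IsQuadGen.ne_zero_of_primitive (hτ : IsQuadGen τ t n) {L : Submodule ℤ V} {x : V}
    (hprim : ∀ α : F, α • x ∈ L → ∃ a b : ℤ, α = a + b * τ) : x ≠ 0 := by
  rintro rfl
  obtain ⟨a, b, e⟩ := hprim (2⁻¹) (by simp)
  have := (hτ.ext_iff (a := 1) (b := 0) (c := 2 * a) (d := 2 * b) (by
    push_cast
    have : (2 : F) * 2⁻¹ = 1 := by norm_num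
    linear_combination 2 * e - this)).1
  omega

/-- A vector whose coefficient ring in `L` is `ℤ[τ]` is part of a splitting of `L`. -/
theorem exists_retraction (hτ : IsQuadGen τ t n) {L : Submodule ℤ V} (hfg : L.FG)
    (hL : ∀ x ∈ L, τ • x ∈ L) {x : V} (hx : x ∈ L)
    (hprim : ∀ α : F, α • x ∈ L → ∃ a b : ℤ, α = a + b * τ) :
    ∃ φ : L →+ F, φ ⟨x, hx⟩ = 1 ∧ (∀ y : L, φ ⟨τ • (y : V), hL y y.2⟩ = τ * φ y) ∧
      ∀ y : L, ∃ a b : ℤ, φ y = a + b * τ := by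
  have hx0 : x ≠ 0 := hτ.ne_zero_of_primitive hprim
  have : Module.Finite ℤ L := Module.Finite.iff_fg.mpr hfg
  let N : Submodule ℤ L := (Submodule.span ℤ {x, τ • x}).comap L.subtype
  have hN : ∀ y : L, y ∈ N ↔ ∃ a b : ℤ, a • x + b • (τ • x) = y := fun y =>
    Submodule.mem_span_pair
  have : Module.IsTorsionFree ℤ (L ⧸ N) := by
    refine Module.IsTorsionFree.of_smul_eq_zero fun d y hdy => ?_
    obtain ⟨y, rfl⟩ := N.mkQ_surjective y
    rw [or_iff_not_imp_left]
    intro hd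
    have hdK : (d : F) ≠ 0 := Int.cast_ne_zero.mpr hd
    rw [← map_zsmul, Submodule.mkQ_apply, Submodule.Quotient.mk_eq_zero, hN] at hdy
    obtain ⟨a, b, e⟩ := hdy
    have hy : (y : V) = ((d : F)⁻¹ * (a + b * τ)) • x := calc
      (y : V) = ((d : F)⁻¹ * d) • (y : V) := by rw [inv_mul_cancel₀ hdK, one_smul]
      _ = (d : F)⁻¹ • (d • (y : V)) := by module
      _ = (d : F)⁻¹ • (a • x + b • (τ • x)) := by rw [e]; rfl
      _ = _ := by module
    obtain ⟨a', b', e'⟩ := hprim _ (hy ▸ y.2)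
    rw [Submodule.mkQ_apply, Submodule.Quotient.mk_eq_zero, hN]
    refine ⟨a', b', ?_⟩
    rw [hy, e']
    module
  obtain ⟨s, hs⟩ := Module.projective_lifting_property N.mkQ LinearMap.id N.mkQ_surjective
  have hsub : ∀ y : L, ∃ a b : ℤ, a • x + b • (τ • x) = ((y - s (N.mkQ y) : L) : V) := by
    intro y
    rw [← hN, ← Submodule.Quotient.mk_eq_zero, ← Submodule.mkQ_apply, map_sub]
    have := LinearMap.congr_fun hs (N.mkQ y)
    rw [LinearMap.comp_apply, LinearMap.id_apply] at this
    rw [this, sub_self]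
  choose A B hAB using hsub
  have huniq : ∀ a b c d : ℤ, a • x + b • (τ • x) = c • x + d • (τ • x) → a = c ∧ b = d := by
    intro a b c d e
    refine hτ.ext_iff (smul_left_injective F hx0 ?_)
    calc ((a : F) + b * τ) • x = a • x + b • (τ • x) := by module
      _ = _ := e
      _ = _ := by module
  have hBadd : ∀ y z, B (y + z) = B y + B z := fun y z => by
    refine (huniq (A (y + z)) _ (A y + A z) _ ?_).2
    calc _ = _ := hAB _
      _ = ((y - s (N.mkQ y) : L) : V) + ((z - s (N.mkQ z) : L) : V) := by
        rw [map_add, map_add, ← Submodule.coe_add]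
        congr 1
        abel
      _ = _ := by rw [← hAB, ← hAB]; module
  have hBN : ∀ (y : L) (a b : ℤ), a • x + b • (τ • x) = y → B y = b := fun y a b e => by
    refine (huniq (A y) _ a _ ?_).2
    have hy : N.mkQ y = 0 := by
      rw [Submodule.mkQ_apply, Submodule.Quotient.mk_eq_zero, hN]
      exact ⟨a, b, e⟩
    rw [hAB, hy, map_zero, sub_zero, e]
  let ℓ : L →+ ℤ := AddMonoidHom.mk' B hBadd
  have hℓ : ∀ y, ℓ y = B y := fun _ => rfl
  let T : L → L := fun y => ⟨τ • (y : V), hL y y.2⟩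
  have hTadd : ∀ y z, T (y + z) = T y + T z := fun y z => Subtype.ext (smul_add τ (y : V) z)
  have hTT : ∀ y, T (T y) = t • T y - n • y := fun y => Subtype.ext (by
    change τ • (τ • (y : V)) = t • (τ • (y : V)) - n • (y : V)
    rw [← mul_smul, hτ.sq]
    module)
  refine ⟨AddMonoidHom.mk' (fun y => ((ℓ (T y) - t * ℓ y : ℤ) : F) + (ℓ y : ℤ) * τ) fun y z => ?_,
    ?_, fun y => ?_, fun y => ⟨_, _, rfl⟩⟩
  · rw [hTadd, map_add, map_add]
    push_cast
    ring
  · change ((ℓ (T ⟨x, hx⟩) - t * ℓ ⟨x, hx⟩ : ℤ) : F) + (ℓ ⟨x, hx⟩ : ℤ) * τ = 1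
    rw [hℓ, hℓ, hBN ⟨x, hx⟩ 1 0 (by simp), hBN (T ⟨x, hx⟩) 0 1 (by simp [T])]
    simp
  · change ((ℓ (T (T y)) - t * ℓ (T y) : ℤ) : F) + (ℓ (T y) : ℤ) * τ =
      τ * (((ℓ (T y) - t * ℓ y : ℤ) : F) + (ℓ y : ℤ) * τ)
    rw [hTT, map_sub, map_zsmul, map_zsmul]
    push_cast [zsmul_eq_mul]
    linear_combination -(ℓ y : F) * hτ.sq

theorem exists_splitting (hτ : IsQuadGen τ t n) {L : Submodule ℤ V} (hfg : L.FG)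
    (hL : ∀ x ∈ L, τ • x ∈ L) (hrank : ∀ u : V, ∃ v ∈ L, v ∉ Submodule.span F {u}) {x : V}
    (hx : x ∈ L) (hprim : ∀ α : F, α • x ∈ L → ∃ a b : ℤ, α = a + b * τ) :
    ∃ y ∈ L, y ∉ Submodule.span F {x} ∧
      ∀ α β : F, α • x + β • y ∈ L ↔ (∃ a b : ℤ, α = a + b * τ) ∧ β • y ∈ L := by
  obtain ⟨φ, hφx, hφτ, hφ⟩ := exists_retraction hτ hfg hL hx hprim
  have hlin : ∀ (a b : ℤ) (z w : L), (w : V) = ((a : F) + b * τ) • (z : V) →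
      φ w = (a + b * τ) * φ z := by
    intro a b z w e
    obtain rfl : w = a • z + b • ⟨τ • (z : V), hL z z.2⟩ := Subtype.ext (by
      rw [e]
      change _ = a • (z : V) + b • (τ • (z : V))
      module)
    rw [map_add, map_zsmul, map_zsmul, hφτ, zsmul_eq_mul, zsmul_eq_mul]
    ring
  have hOL : ∀ (a b : ℤ) (z : V), z ∈ L → ((a : F) + b * τ) • z ∈ L := fun a b z hz => by
    have := L.add_mem (L.smul_mem a hz) (L.smul_mem b (hL z hz))
    convert this using 1
    module
  obtain ⟨v, hv, hvx⟩ := hrank x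
  obtain ⟨a₀, b₀, e₀⟩ := hφ ⟨v, hv⟩
  have hyL : v - ((a₀ : F) + b₀ * τ) • x ∈ L := L.sub_mem hv (hOL _ _ _ hx)
  have hφy : φ ⟨v - ((a₀ : F) + b₀ * τ) • x, hyL⟩ = 0 := by
    have h1 : (⟨v - ((a₀ : F) + b₀ * τ) • x, hyL⟩ : L) =
      ⟨v, hv⟩ - ⟨((a₀ : F) + b₀ * τ) • x, hOL _ _ _ hx⟩ := rfl
    rw [h1, map_sub, e₀, hlin a₀ b₀ ⟨x, hx⟩ _ rfl, hφx]
    ring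
  refine ⟨_, hyL, fun h => hvx ?_, fun α β => ⟨fun h => ?_, ?_⟩⟩
  · have := (Submodule.span F {x}).add_mem h
      ((Submodule.span F {x}).smul_mem ((a₀ : F) + b₀ * τ) (Submodule.mem_span_singleton_self x))
    rwa [sub_add_cancel] at this
  · set y := v - ((a₀ : F) + b₀ * τ) • x with hy
    have hα : φ ⟨_, h⟩ = α := by
      obtain ⟨d₁, hd₁, a₁, b₁, e₁⟩ := hτ.denom α
      obtain ⟨d₂, hd₂, a₂, b₂, e₂⟩ := hτ.denom β
      have h1 : (d₁ * d₂) • (⟨_, h⟩ : L) =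
          d₂ • ⟨((a₁ : F) + b₁ * τ) • x, hOL _ _ _ hx⟩ +
          d₁ • ⟨((a₂ : F) + b₂ * τ) • y, hOL _ _ _ hyL⟩ := Subtype.ext (by
        change (d₁ * d₂) • (α • x + β • y) =
          d₂ • (((a₁ : F) + b₁ * τ) • x) + d₁ • (((a₂ : F) + b₂ * τ) • y)
        rw [← e₁, ← e₂]
        module)
      have h2 := congrArg φ h1
      rw [map_zsmul, map_add, map_zsmul, map_zsmul, hlin a₁ b₁ ⟨x, hx⟩ ⟨_, hOL _ _ _ hx⟩ rfl,
        hlin a₂ b₂ ⟨y, hyL⟩ ⟨_, hOL _ _ _ hyL⟩ rfl, hφx, hφy, zsmul_eq_mul, zsmul_eq_mul, ← e₁] at h2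
      have hd : ((d₁ * d₂ : ℤ) : F) ≠ 0 := Int.cast_ne_zero.mpr (mul_ne_zero hd₁ hd₂)
      refine mul_left_cancel₀ hd ?_
      rw [h2]
      push_cast
      simp
      ring
    obtain ⟨a, b, e⟩ := hφ ⟨_, h⟩
    have hα' : α = a + b * τ := hα.symm.trans e
    refine ⟨⟨a, b, hα'⟩, ?_⟩
    have := L.sub_mem h (hα' ▸ hOL a b x hx : α • x ∈ L)
    rwa [add_sub_cancel_left] at this
  · rintro ⟨⟨a, b, rfl⟩, h⟩
    exact L.add_mem (hOL a b x hx) h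

end Splitting

section NumberField

open NumberField

variable {K} in
theorem exists_isIntegralGen (hdeg : Module.finrank ℚ K = 2) :
    ∃ (ω : K) (t n : ℤ), IsIntegralGen ω t n := by
  have hrank : Module.finrank ℤ (𝓞 K) = 2 := (RingOfIntegers.rank K).trans hdeg
  let B : Module.Basis (Fin 2) ℤ (𝓞 K) := Module.finBasisOfFinrankEq ℤ (𝓞 K) hrank
  have hB : ∀ y : 𝓞 K, y = B.repr y 0 * B 0 + B.repr y 1 * B 1 := fun y => by
    conv_lhs => rw [← B.sum_repr y]
    simp [Fin.sum_univ_two]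
  have hB0 : ∀ a b : ℤ, (a : 𝓞 K) * B 0 + b * B 1 = 0 → a = 0 ∧ b = 0 := fun a b e => by
    have := Fintype.linearIndependent_iff.mp B.linearIndependent ![a, b]
      (by simpa [Fin.sum_univ_two] using e)
    exact ⟨this 0, this 1⟩
  obtain ⟨r, s, h1⟩ : ∃ r s : ℤ, (1 : 𝓞 K) = r * B 0 + s * B 1 := ⟨_, _, hB 1⟩
  have hrs : IsCoprime r s := by
    rw [Int.isCoprime_iff_gcd_eq_one]
    obtain ⟨r', hr'⟩ := Int.gcd_dvd_left r s
    obtain ⟨s', hs'⟩ := Int.gcd_dvd_right r s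
    set d := Int.gcd r s
    have h2 : (1 : 𝓞 K) = algebraMap ℤ (𝓞 K) d * (r' * B 0 + s' * B 1) := by
      rw [h1, hr', hs']
      simp
      ring
    have h3 := congrArg (Algebra.norm ℤ) h2
    rw [map_one, map_mul, Algebra.norm_algebraMap_of_basis B] at h3
    have h4 : (d : ℤ) ∣ 1 := by
      rw [h3]
      exact (dvd_pow_self _ (by simp)).mul_right _
    exact Int.natCast_dvd_natCast.mp h4 |> Nat.dvd_one.mp
  obtain ⟨u, v, huv⟩ := hrs
  let w : 𝓞 K := -v * B 0 + u * B 1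
  have huv' : (u : 𝓞 K) * r + v * s = 1 := by exact_mod_cast congrArg (Int.cast : ℤ → 𝓞 K) huv
  have hspan : ∀ y : 𝓞 K, ∃ a b : ℤ, y = a + b * w := fun y => by
    refine ⟨B.repr y 0 * u + B.repr y 1 * v, -B.repr y 0 * s + B.repr y 1 * r, ?_⟩
    conv_lhs => rw [hB y]
    push_cast
    have e0 : B 0 = u - s * w := by
      linear_combination (-B 0) * huv' - u * h1
    have e1 : B 1 = v + r * w := by
      linear_combination (-B 1) * huv' - v * h1
    rw [e0, e1]
    ring
  obtain ⟨n, t, hw⟩ := hspan (w * w)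
  have hcast : ∀ a b : ℤ, ((a + b * w : 𝓞 K) : K) = a + b * (w : K) := by simp
  have hint : ∀ x : K, IsIntegral ℤ x ↔ ∃ a b : ℤ, x = a + b * (w : K) := fun x => by
    constructor
    · intro hx
      obtain ⟨a, b, e⟩ := hspan ⟨x, hx⟩
      exact ⟨a, b, by rw [← hcast, ← e]; rfl⟩
    · rintro ⟨a, b, rfl⟩
      rw [← hcast]
      exact RingOfIntegers.isIntegral_coe _
  refine ⟨w, t, -n, ⟨⟨?_, fun a b e => ?_, fun x => ?_⟩, hint⟩⟩
  · have : (w : K) * w = n + t * w := by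
      rw [← hcast, ← hw]
      exact (map_mul (algebraMap (𝓞 K) K) w w).symm
    rw [this]
    push_cast
    ring
  · rw [← hcast] at e
    have e' : (a + b * w : 𝓞 K) = 0 := RingOfIntegers.coe_eq_zero_iff.mp e
    obtain ⟨h2, h3⟩ := hB0 (a * r - b * v) (a * s + b * u) (by
      push_cast
      linear_combination e' - a * h1)
    constructor
    · linear_combination -a * huv + u * h2 + v * h3
    · linear_combination -b * huv - s * h2 + r * h3
  · obtain ⟨d, hd, h⟩ := ((IsFractionRing.isAlgebraic_iff ℤ ℚ K).mpr
      (Algebra.IsAlgebraic.isAlgebraic x)).exists_integral_multiple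
    rw [hint, zsmul_eq_mul] at h
    exact ⟨d, hd, h⟩

end NumberField

section Lattice

variable {K} {ω : K} {t n : ℤ}

omit [NumberField K] in
theorem mem_orderSet_iff (hω : IsIntegralGen ω t n) (m : ℕ) (x : K) :
    x ∈ orderSet K m ↔ ∃ a b : ℤ, x = a + b * (m * ω) := by
  constructor
  · rintro ⟨a, y, rfl⟩
    obtain ⟨c, d, e⟩ := (hω.isIntegral_iff _).mp (NumberField.RingOfIntegers.isIntegral_coe y)
    exact ⟨a + m * c, d, by rw [e]; push_cast; ring⟩
  · rintro ⟨a, b, rfl⟩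
    have h : IsIntegral ℤ (b * ω) := (hω.isIntegral_iff _).mpr ⟨0, b, by simp⟩
    refine ⟨a, ⟨b * ω, h⟩, ?_⟩
    change _ = (a : K) + m * (b * ω)
    ring

theorem dvd_of_orderSet_subset (hω : IsIntegralGen ω t n) {f g : ℕ}
    (h : orderSet K f ⊆ orderSet K g) : g ∣ f := by
  obtain ⟨a, b, e⟩ := (mem_orderSet_iff hω g _).mp
    (h ((mem_orderSet_iff hω f (f * ω)).mpr ⟨0, 1, by simp⟩))
  have := (hω.toIsQuadGen.ext_iff (a := 0) (b := f) (c := a) (d := b * g) (by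
    push_cast; linear_combination e)).2
  exact Int.natCast_dvd_natCast.mp ⟨b, by rw [this]; ring⟩

omit [NumberField K] in
theorem orderSet_subset_of_dvd {f g : ℕ} (h : g ∣ f) : orderSet K f ⊆ orderSet K g := by
  obtain ⟨c, rfl⟩ := h
  rintro _ ⟨a, y, rfl⟩
  exact ⟨a, c * y, by push_cast [map_mul, map_natCast]; ring⟩

theorem orderSet_injective (hω : IsIntegralGen ω t n) : Function.Injective (orderSet K) :=
  fun _ _ h => Nat.dvd_antisymm (dvd_of_orderSet_subset hω h.ge) (dvd_of_orderSet_subset hω h.le)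

omit [NumberField K] in
theorem mul_mem_orderSet {m : ℕ} {x y : K} (hx : x ∈ orderSet K m) (hy : y ∈ orderSet K m) :
    x * y ∈ orderSet K m := by
  obtain ⟨a, u, rfl⟩ := hx
  obtain ⟨b, v, rfl⟩ := hy
  refine ⟨a * b, a * v + b * u + m * (u * v), ?_⟩
  push_cast [map_add, map_mul, map_natCast, map_intCast]
  ring

omit [NumberField K] in
theorem one_mem_orderSet (m : ℕ) : (1 : K) ∈ orderSet K m := ⟨1, 0, by simp⟩

theorem exists_zsmul_mem_of_span_eq_top {V : Type*} [AddCommGroup V] [Module ℚ V]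
    {L : Submodule ℤ V} (h : Submodule.span ℚ (L : Set V) = ⊤) (x : V) :
    ∃ d : ℤ, d ≠ 0 ∧ d • x ∈ L := by
  have hx : x ∈ Submodule.span ℚ (L : Set V) := h ▸ Submodule.mem_top
  induction hx using Submodule.span_induction with
  | mem x hx => exact ⟨1, one_ne_zero, by simpa using hx⟩
  | zero => exact ⟨1, one_ne_zero, by simp⟩
  | add x y _ _ hx hy =>
    obtain ⟨c, hc, hcx⟩ := hx
    obtain ⟨d, hd, hdy⟩ := hy
    refine ⟨c * d, mul_ne_zero hc hd, ?_⟩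
    convert L.add_mem (L.smul_mem d hcx) (L.smul_mem c hdy) using 1
    module
  | smul q x _ hx =>
    obtain ⟨c, hc, hcx⟩ := hx
    refine ⟨q.den * c, by simp [hc], ?_⟩
    convert L.smul_mem q.num hcx using 1
    have : (q.den : ℚ) * q = q.num := Rat.den_mul_eq_num q
    calc ((q.den : ℤ) * c) • q • x = c • (((q.den : ℚ) * q) • x) := by module
      _ = _ := by rw [this]; module

omit [NumberField K] in
theorem mem_latPair {A B : Submodule ℤ K} {v : Fin 2 → K} :
    v ∈ latPair K A B ↔ v 0 ∈ A ∧ v 1 ∈ B := Iff.rfl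

/-- The `ℤ`-span of the determinants of pairs of vectors of `M`. -/
def detLat (M : Submodule ℤ (Fin 2 → K)) : Submodule ℤ K :=
  Submodule.span ℤ {d | ∃ x ∈ M, ∃ y ∈ M, d = x 0 * y 1 - x 1 * y 0}

omit [NumberField K] in
theorem detLat_map (γ : Matrix (Fin 2) (Fin 2) K) (M : Submodule ℤ (Fin 2 → K)) :
    detLat (M.map ((Matrix.mulVecLin γ).restrictScalars ℤ)) = γ.det • detLat M := by
  have key : ∀ x y : Fin 2 → K, γ.mulVec x 0 * γ.mulVec y 1 - γ.mulVec x 1 * γ.mulVec y 0 =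
      γ.det * (x 0 * y 1 - x 1 * y 0) := fun x y => by
    simp only [Matrix.mulVec, dotProduct, Fin.sum_univ_two, Matrix.det_fin_two]
    ring
  rw [detLat, detLat, Submodule.smul_span]
  congr 1
  ext d
  constructor
  · rintro ⟨_, ⟨x, hx, rfl⟩, _, ⟨y, hy, rfl⟩, rfl⟩
    exact ⟨_, ⟨x, hx, y, hy, rfl⟩, (key x y).symm⟩
  · rintro ⟨_, ⟨x, hx, y, hy, rfl⟩, rfl⟩
    exact ⟨_, ⟨x, hx, rfl⟩, _, ⟨y, hy, rfl⟩, (key x y).symm⟩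

theorem detLat_latPair {f f' : ℕ} (hff : f' ∣ f) {𝔞 : Submodule ℤ K} (h𝔞 : HasCond K 𝔞 f') :
    detLat (latPair K (orderLat K f) 𝔞) = 𝔞 := by
  have hmul : ∀ α ∈ orderSet K f, ∀ x ∈ 𝔞, α * x ∈ 𝔞 := fun α hα => by
    have : α ∈ (multLat K 𝔞 : Set K) := h𝔞.2 ▸ orderSet_subset_of_dvd hff hα
    exact this
  apply le_antisymm
  · rw [detLat, Submodule.span_le]
    rintro _ ⟨x, hx, y, hy, rfl⟩
    exact 𝔞.sub_mem (hmul _ hx.1 _ hy.2) (by rw [mul_comm]; exact hmul _ hy.1 _ hx.2)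
  · intro a ha
    refine Submodule.subset_span ⟨![1, 0], ⟨one_mem_orderSet f, 𝔞.zero_mem⟩, ![0, a],
      ⟨(orderLat K f).zero_mem, ha⟩, by simp⟩

theorem smul_mem_latPair_iff {f f' : ℕ} (hff : f' ∣ f) {𝔞 : Submodule ℤ K}
    (h𝔞 : HasCond K 𝔞 f') (α : K) :
    (∀ x ∈ latPair K (orderLat K f) 𝔞, α • x ∈ latPair K (orderLat K f) 𝔞) ↔
      α ∈ orderSet K f := by
  constructor
  · intro h
    have : α * 1 ∈ orderSet K f := (h ![1, 0] ⟨one_mem_orderSet f, 𝔞.zero_mem⟩).1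
    rwa [mul_one] at this
  · intro hα x hx
    have hα' : α ∈ (multLat K 𝔞 : Set K) := h𝔞.2 ▸ orderSet_subset_of_dvd hff hα
    exact ⟨mul_mem_orderSet hα hx.1, hα' _ hx.2⟩

omit [NumberField K] in
theorem smul_mem_map_iff {γ : Matrix (Fin 2) (Fin 2) K} (hγ : IsUnit γ)
    (M : Submodule ℤ (Fin 2 → K)) (α : K) :
    (∀ x ∈ M.map ((Matrix.mulVecLin γ).restrictScalars ℤ),
      α • x ∈ M.map ((Matrix.mulVecLin γ).restrictScalars ℤ)) ↔ ∀ x ∈ M, α • x ∈ M := by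
  have hinj : Function.Injective γ.mulVec := Matrix.mulVec_injective_iff_isUnit.mpr hγ
  constructor
  · intro h x hx
    obtain ⟨y, hy, e⟩ := h _ ⟨x, hx, rfl⟩
    have : y = α • x := hinj (by rw [Matrix.mulVec_smul]; exact e)
    exact this ▸ hy
  · rintro h _ ⟨x, hx, rfl⟩
    exact ⟨α • x, h x hx, Matrix.mulVec_smul γ α x⟩

theorem canonical_form_unique (hω : IsIntegralGen ω t n) {M : Submodule ℤ (Fin 2 → K)}
    {f f' g g' : ℕ} {𝔞 𝔟 : Submodule ℤ K} (hff : f' ∣ f) (hgg : g' ∣ g)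
    (h𝔞 : HasCond K 𝔞 f') (h𝔟 : HasCond K 𝔟 g') {γ γ' : Matrix (Fin 2) (Fin 2) K}
    (hγ : IsUnit γ) (hγ' : IsUnit γ')
    (hM : M.map ((Matrix.mulVecLin γ).restrictScalars ℤ) = latPair K (orderLat K f) 𝔞)
    (hM' : M.map ((Matrix.mulVecLin γ').restrictScalars ℤ) = latPair K (orderLat K g) 𝔟) :
    g = f ∧ g' = f' ∧ ∃ lam : K, lam ≠ 0 ∧ 𝔟 = lam • 𝔞 := by
  have hd : γ.det ≠ 0 := ((Matrix.isUnit_iff_isUnit_det γ).mp hγ).ne_zero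
  have hd' : γ'.det ≠ 0 := ((Matrix.isUnit_iff_isUnit_det γ').mp hγ').ne_zero
  have h1 : γ.det • detLat M = 𝔞 := by rw [← detLat_map, hM, detLat_latPair hff h𝔞]
  have h2 : γ'.det • detLat M = 𝔟 := by rw [← detLat_map, hM', detLat_latPair hgg h𝔟]
  have hlam : 𝔟 = (γ'.det * γ.det⁻¹) • 𝔞 := by
    rw [← h1, ← h2, smul_smul, inv_mul_cancel_right₀ hd]
  have hlam0 : γ'.det * γ.det⁻¹ ≠ 0 := mul_ne_zero hd' (inv_ne_zero hd)
  refine ⟨orderSet_injective hω (Set.ext fun α => ?_), orderSet_injective hω ?_, _, hlam0, hlam⟩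
  · rw [← smul_mem_latPair_iff hgg h𝔟, ← smul_mem_latPair_iff hff h𝔞, ← hM, ← hM',
      smul_mem_map_iff hγ, smul_mem_map_iff hγ']
  · rw [← h𝔞.2, ← h𝔟.2, hlam]
    generalize γ'.det * γ.det⁻¹ = l at hlam0
    ext α
    constructor
    · intro h x hx
      obtain ⟨y, hy, e⟩ := (Submodule.mem_smul_pointwise_iff_exists _ _ _).mp
        (h (l * x) (Submodule.smul_mem_pointwise_smul x l 𝔞 hx))
      have : y = α * x := mul_left_cancel₀ hlam0 (by rw [← smul_eq_mul, e]; ring)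
      exact this ▸ hy
    · intro h x hx
      obtain ⟨y, hy, rfl⟩ := (Submodule.mem_smul_pointwise_iff_exists _ _ _).mp hx
      rw [smul_eq_mul, mul_left_comm]
      exact Submodule.smul_mem_pointwise_smul _ l 𝔞 (h y hy)

theorem exists_notMem_span_singleton {M : Submodule ℤ (Fin 2 → K)}
    (hMspan : Submodule.span ℚ (M : Set (Fin 2 → K)) = ⊤) (u : Fin 2 → K) :
    ∃ v ∈ M, v ∉ Submodule.span K {u} := by
  by_contra! H
  have h1 : Submodule.span ℚ (M : Set (Fin 2 → K)) ≤
      (Submodule.span K {u}).restrictScalars ℚ := Submodule.span_le.mpr H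
  have h2 : Submodule.span K {u} = ⊤ := by
    rw [hMspan] at h1
    exact eq_top_iff.mpr fun x _ => h1 Submodule.mem_top
  have h3 := finrank_span_le_card (R := K) ({u} : Set (Fin 2 → K))
  rw [h2, finrank_top, Module.finrank_fin_fun] at h3
  simp at h3

omit [NumberField K] in
theorem isUnit_of_notMem_span {x y : Fin 2 → K} (hx : x ≠ 0) (hy : y ∉ Submodule.span K {x}) :
    IsUnit (!![x 0, y 0; x 1, y 1] : Matrix (Fin 2) (Fin 2) K) := by
  rw [Matrix.isUnit_iff_isUnit_det, isUnit_iff_ne_zero, Matrix.det_fin_two_of]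
  intro h
  apply hy
  rw [Submodule.mem_span_singleton]
  by_cases h0 : x 0 = 0
  · have h1 : x 1 ≠ 0 := fun h1 => hx (by ext i; fin_cases i <;> assumption)
    have hy0 : y 0 = 0 := by simpa [h0, h1] using h
    refine ⟨y 1 / x 1, ?_⟩
    ext i
    fin_cases i <;> simp [h0, hy0, h1]
  · refine ⟨y 0 / x 0, ?_⟩
    ext i
    fin_cases i
    · simp [h0]
    · simp
      field_simp
      linear_combination -h

end Lattice

/-- Every full `ℤ`-lattice `M ⊆ K²` can be moved by an element of `GL₂(K)` to a lattice
of the canonical form `O_f ⊕ 𝔞`, with `𝔞` of conductor `f′ ∣ f`; the integers `f, f′`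
are uniquely determined by `M` and `𝔞` is unique up to homothety. -/
theorem canonical_form
    (hdeg : Module.finrank ℚ K = 2)
    (himag : IsEmpty (K →+* ℝ))
    (M : Submodule ℤ (Fin 2 → K)) (hMfg : M.FG)
    (hMspan : Submodule.span ℚ (M : Set (Fin 2 → K)) = ⊤) :
    ∃ (f f' : ℕ) (𝔞 : Submodule ℤ K),
      0 < f ∧ f' ∣ f ∧ IsLat K 𝔞 ∧ HasCond K 𝔞 f' ∧
      (∃ γ : Matrix (Fin 2) (Fin 2) K, IsUnit γ ∧
        Submodule.map ((Matrix.mulVecLin γ).restrictScalars ℤ) M =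
          latPair K (orderLat K f) 𝔞) ∧
      (∀ (g g' : ℕ) (𝔟 : Submodule ℤ K),
        0 < g → g' ∣ g → IsLat K 𝔟 → HasCond K 𝔟 g' →
        (∃ γ' : Matrix (Fin 2) (Fin 2) K, IsUnit γ' ∧
          Submodule.map ((Matrix.mulVecLin γ').restrictScalars ℤ) M =
            latPair K (orderLat K g) 𝔟) →
        g = f ∧ g' = f' ∧ ∃ lam : K, lam ≠ 0 ∧ 𝔟 = lam • 𝔞) := by
  obtain ⟨ω, t, n, hω⟩ := exists_isIntegralGen hdeg
  have hMfull := exists_zsmul_mem_of_span_eq_top hMspan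
  have hMrank := exists_notMem_span_singleton hMspan
  have hMne : M ≠ ⊥ := by
    rintro rfl
    obtain ⟨v, hv, hv'⟩ := hMrank 0
    obtain rfl := (Submodule.mem_bot ℤ).mp hv
    exact hv' (Submodule.zero_mem _)
  obtain ⟨f, hf, hfM⟩ := exists_conductor hω hMfg hMne hMfull
  obtain ⟨x, hx, hprim⟩ := exists_primitive_vector hω hf hMfg hfM hMrank
  have hτM : ∀ z ∈ M, ((f : K) * ω) • z ∈ M := (hfM _).mpr ⟨0, 1, by simp⟩
  have hτ := hω.toIsQuadGen.nat_mul hf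
  obtain ⟨y, hy, hyx, hsplit⟩ := exists_splitting hτ hMfg hτM hMrank hx hprim
  have hx0 := hτ.ne_zero_of_primitive hprim
  have hy0 : y ≠ 0 := fun h => hyx (h ▸ Submodule.zero_mem _)
  let g : K →ₗ[ℤ] (Fin 2 → K) := (LinearMap.toSpanSingleton K (Fin 2 → K) y).restrictScalars ℤ
  have hginj : Function.Injective g := smul_left_injective K hy0
  let 𝔞 : Submodule ℤ K := M.comap g
  have h𝔞 : ∀ β, β ∈ 𝔞 ↔ β • y ∈ M := fun β => Iff.rfl
  have h𝔞fg : 𝔞.FG := by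
    have : IsNoetherian ℤ M := isNoetherian_of_fg_of_noetherian M hMfg
    exact Submodule.fg_of_fg_map_injective g hginj
      (Submodule.FG.of_le hMfg (Submodule.map_comap_le g M))
  have h𝔞full : ∀ β : K, ∃ d : ℤ, d ≠ 0 ∧ d • β ∈ 𝔞 := fun β => by
    obtain ⟨d, hd, h⟩ := hMfull (β • y)
    exact ⟨d, hd, by rwa [h𝔞, smul_assoc]⟩
  have h𝔞span : Submodule.span ℚ (𝔞 : Set K) = ⊤ := by
    refine eq_top_iff.mpr fun β _ => ?_
    obtain ⟨d, hd, h⟩ := h𝔞full β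
    have hd' : (d : ℚ) ≠ 0 := Int.cast_ne_zero.mpr hd
    have : β = (d : ℚ)⁻¹ • (d • β) := by
      rw [← Int.cast_smul_eq_zsmul ℚ, smul_smul, inv_mul_cancel₀ hd', one_smul]
    rw [this]
    exact Submodule.smul_mem _ _ (Submodule.subset_span h)
  have h𝔞ne : 𝔞 ≠ ⊥ := fun h => one_ne_zero ((Submodule.mem_bot ℤ).mp
    (h ▸ (h𝔞 1).mpr (by rwa [one_smul]) : (1 : K) ∈ (⊥ : Submodule ℤ K)))
  obtain ⟨f', hf', hf𝔞⟩ := exists_conductor hω h𝔞fg h𝔞ne h𝔞full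
  have hcond : HasCond K 𝔞 f' :=
    ⟨hf', Set.ext fun α => (hf𝔞 α).trans (mem_orderSet_iff hω f' α).symm⟩
  have hff : f' ∣ f := dvd_of_orderSet_subset hω fun α hα => by
    rw [← hcond.2]
    intro β hβ
    rw [h𝔞, mul_smul]
    exact (hfM α).mpr ((mem_orderSet_iff hω f α).mp hα) _ hβ
  have hA := isUnit_of_notMem_span hx0 hyx
  set A : Matrix (Fin 2) (Fin 2) K := !![x 0, y 0; x 1, y 1] with hAdef
  have hAmul : ∀ v : Fin 2 → K, A.mulVec v = v 0 • x + v 1 • y := fun v => by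
    ext i
    fin_cases i <;> simp [hAdef, Matrix.mulVec, dotProduct, Fin.sum_univ_two] <;> ring
  have hAdet := (Matrix.isUnit_iff_isUnit_det A).mp hA
  have hγ : IsUnit A⁻¹ := (Matrix.isUnit_nonsing_inv_iff).mpr hA
  have hmap : M.map ((Matrix.mulVecLin A⁻¹).restrictScalars ℤ) = latPair K (orderLat K f) 𝔞 := by
    ext w
    have h1 : w ∈ latPair K (orderLat K f) 𝔞 ↔ A.mulVec w ∈ M := by
      rw [hAmul, hsplit, mem_latPair, h𝔞]
      exact and_congr_left fun _ => mem_orderSet_iff hω f (w 0)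
    rw [h1]
    constructor
    · rintro ⟨z, hz, rfl⟩
      change A.mulVec (A⁻¹.mulVec z) ∈ M
      rwa [Matrix.mulVec_mulVec, Matrix.mul_nonsing_inv A hAdet, Matrix.one_mulVec]
    · intro h
      refine ⟨_, h, ?_⟩
      change A⁻¹.mulVec (A.mulVec w) = w
      rw [Matrix.mulVec_mulVec, Matrix.nonsing_inv_mul A hAdet, Matrix.one_mulVec]
  refine ⟨f, f', 𝔞, hf, hff, ⟨h𝔞fg, h𝔞span⟩, hcond, ⟨_, hγ, hmap⟩, ?_⟩
  rintro g g' 𝔟 - hgg - h𝔟 ⟨γ', hγ', hmap'⟩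
  exact canonical_form_unique hω hff hgg hcond h𝔟 hγ hγ' hmap hmap'

end
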